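/- Estimation error bound under noisy similarity confidence (Theorem 6): Let s̄: 𝒳 × 𝒳 → [0,1] be any measurable function (the noisy similarity confidence), let R̄(g) be defined exactly as R̂(g) but with sᵢ replaced by s̄ᵢ = s̄(Xᵢ,Xᵢ'), let ḡ be a minimizer of R̄ over 𝒢 and g* a minimizer of R over 𝒢 (both assumed to exist), and let σₙ = Σᵢ |sᵢ − s̄ᵢ|. For any δ ∈ (0,1), with probability at least 1−δ over the draw of the n i.i.d. pairs, R(ḡ) − R(g*) ≤ 4·L_ℓ·𝔑ₙ(𝒢)/|π₊−π₋| + (4·C_ℓ/|π₊−π₋|)·√(ln(2/δ)/(2n)) + 2·C_ℓ·σₙ/(n·|π₊−π₋|). -/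

import Mathlib

open MeasureTheory ProbabilityTheory
open scoped ENNReal BigOperators

section Supremum

variable {ι : Type*}

theorem bddAbove_range_of_abs_le {f : ι → ℝ} {B : ℝ} (hf : ∀ i, |f i| ≤ B) :
    BddAbove (Set.range f) :=
  ⟨B, by rintro _ ⟨i, rfl⟩; exact (abs_le.1 (hf i)).2⟩

theorem abs_ciSup_le [Nonempty ι] {f : ι → ℝ} {B : ℝ} (hf : ∀ i, |f i| ≤ B) :
    |⨆ i, f i| ≤ B := by
  refine abs_le.2 ⟨?_, ciSup_le fun i => (abs_le.1 (hf i)).2⟩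
  obtain ⟨i⟩ := ‹Nonempty ι›
  exact (abs_le.1 (hf i)).1.trans (le_ciSup (bddAbove_range_of_abs_le hf) i)

theorem ciSup_midpoint_le [Nonempty ι] {f g h : ι → ℝ} (hf : BddAbove (Set.range f))
    (hg : BddAbove (Set.range g)) (hh : ∀ i, h i = (f i + g i) / 2) :
    ⨆ i, h i ≤ ((⨆ i, f i) + ⨆ i, g i) / 2 :=
  ciSup_le fun i => by
    rw [hh i]
    linarith [le_ciSup hf i, le_ciSup hg i]

/-- The one-step form of Talagrand's contraction principle. -/
theorem ciSup_add_add_ciSup_sub_le [Nonempty ι] {b φ ψ : ι → ℝ}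
    (h : ∀ i j, |φ i - φ j| ≤ |ψ i - ψ j|)
    (h₁ : BddAbove (Set.range fun i => b i + ψ i))
    (h₂ : BddAbove (Set.range fun i => b i - ψ i)) :
    (⨆ i, (b i + φ i)) + ⨆ i, (b i - φ i) ≤ (⨆ i, (b i + ψ i)) + ⨆ i, (b i - ψ i) := by
  rw [← le_sub_iff_add_le]
  refine ciSup_le fun i => ?_
  rw [le_sub_comm]
  refine ciSup_le fun j => ?_
  have hi₁ := le_ciSup h₁ i
  have hi₂ := le_ciSup h₂ i
  have hj₁ := le_ciSup h₁ j
  have hj₂ := le_ciSup h₂ j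
  have hij := (le_abs_self _).trans (h i j)
  rcases abs_cases (ψ i - ψ j) with ⟨h', _⟩ | ⟨h', _⟩ <;> rw [h'] at hij <;> linarith

end Supremum

theorem abs_sum_fin_le {Z : Type*} {h : Z → ℝ} {C : ℝ} (hC : ∀ z, |h z| ≤ C) {n : ℕ}
    (z : Fin n → Z) : |∑ j, h (z j)| ≤ n * C :=
  (Finset.abs_sum_le_sum_abs _ _).trans
    ((Finset.sum_le_sum fun j _ => hC (z j)).trans (by simp))

section ProductMeasure

variable {Y W : Type*} [MeasurableSpace Y] [MeasurableSpace W]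

theorem integrable_of_abs_le {m : Measure Y} [IsFiniteMeasure m] {f : Y → ℝ} (hf : Measurable f)
    {B : ℝ} (hB : ∀ y, |f y| ≤ B) : Integrable f m :=
  Integrable.of_bound hf.aestronglyMeasurable B (.of_forall hB)

theorem abs_integral_le_of_abs_le {m : Measure Y} [IsProbabilityMeasure m] {f : Y → ℝ} {B : ℝ}
    (hB : ∀ y, |f y| ≤ B) : |∫ y, f y ∂m| ≤ B := by
  simpa using norm_integral_le_of_norm_le_const (μ := m) (f := f) (.of_forall hB)

theorem measurable_fin_cons {n : ℕ} :
    Measurable fun p : Y × (Fin n → Y) => (Fin.cons p.1 p.2 : Fin (n + 1) → Y) := by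
  refine measurable_pi_lambda _ fun i => ?_
  cases i using Fin.cases with
  | zero => simpa using measurable_fst
  | succ i =>
    simp only [Fin.cons_succ]
    fun_prop

theorem integral_pi_succ {m : Measure Y} [IsProbabilityMeasure m] {n : ℕ}
    {F : (Fin (n + 1) → Y) → ℝ} (hF : Measurable F) {B : ℝ} (hB : ∀ ω, |F ω| ≤ B) :
    ∫ ω, F ω ∂(Measure.pi fun _ : Fin (n + 1) => m) =
      ∫ y, ∫ ω : Fin n → Y, F (Fin.cons y ω) ∂(Measure.pi fun _ : Fin n => m) ∂m := by
  have h := (measurePreserving_piFinSuccAbove (fun _ : Fin (n + 1) => m) 0).symm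
  rw [← h.integral_comp' F]
  have h' : ∀ p : Y × (Fin n → Y),
      (MeasurableEquiv.piFinSuccAbove (fun _ : Fin (n + 1) => Y) 0).symm p = Fin.cons p.1 p.2 :=
    fun p => Fin.insertNth_zero' p.1 p.2
  simp_rw [h']
  exact integral_prod _ (integrable_of_abs_le (hF.comp measurable_fin_cons) fun p => hB _)

/-- If `f` is dominated by `k` in expected supremum for one coordinate, then so it is for sums over
independent coordinates. -/
theorem integral_ciSup_sum_le {ι : Type*} [Countable ι] [Nonempty ι]
    (m₁ : Measure Y) (m₂ : Measure W) [IsProbabilityMeasure m₁] [IsProbabilityMeasure m₂]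
    {f : ι → Y → ℝ} {k : ι → W → ℝ} (hf : ∀ i, Measurable (f i)) (hk : ∀ i, Measurable (k i))
    {Bf Bk : ℝ} (hBf : ∀ i y, |f i y| ≤ Bf) (hBk : ∀ i w, |k i w| ≤ Bk)
    (H : ∀ (b : ι → ℝ) (B : ℝ), (∀ i, |b i| ≤ B) →
      ∫ y, (⨆ i, (b i + f i y)) ∂m₁ ≤ ∫ w, (⨆ i, (b i + k i w)) ∂m₂)
    (n : ℕ) (a : ι → ℝ) (A : ℝ) (ha : ∀ i, |a i| ≤ A) :
    ∫ y : Fin n → Y, (⨆ i, (a i + ∑ j, f i (y j))) ∂(Measure.pi fun _ => m₁) ≤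
      ∫ w : Fin n → W, (⨆ i, (a i + ∑ j, k i (w j))) ∂(Measure.pi fun _ => m₂) := by
  induction n generalizing a A with
  | zero => simp
  | succ n ih =>
    have bf : ∀ (n : ℕ) (y : Fin n → Y) i, |a i + ∑ j, f i (y j)| ≤ A + n * Bf := fun n y i =>
      (abs_add_le _ _).trans (add_le_add (ha i) (abs_sum_fin_le (hBf i) y))
    have bk : ∀ (n : ℕ) (w : Fin n → W) i, |a i + ∑ j, k i (w j)| ≤ A + n * Bk := fun n w i =>
      (abs_add_le _ _).trans (add_le_add (ha i) (abs_sum_fin_le (hBk i) w))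
    have bfk : ∀ (w : Fin n → W) y i, |a i + f i y + ∑ j, k i (w j)| ≤ A + Bf + n * Bk :=
      fun w y i => (abs_add_le _ _).trans (add_le_add ((abs_add_le _ _).trans
        (add_le_add (ha i) (hBf i y))) (abs_sum_fin_le (hBk i) w))
    have bkk : ∀ (w : Fin n → W) w' i, |a i + ∑ j, k i (w j) + k i w'| ≤ A + n * Bk + Bk :=
      fun w w' i => (abs_add_le _ _).trans (add_le_add (bk n w i) (hBk i w'))
    have baf : ∀ y i, |a i + f i y| ≤ A + Bf := fun y i =>
      (abs_add_le _ _).trans (add_le_add (ha i) (hBf i y))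
    have mfk : Measurable fun p : Y × (Fin n → W) => ⨆ i, (a i + f i p.1 + ∑ j, k i (p.2 j)) :=
      .iSup fun i => by have := hf i; have := hk i; fun_prop
    have mkk : Measurable fun p : W × (Fin n → W) => ⨆ i, (a i + ∑ j, k i (p.2 j) + k i p.1) :=
      .iSup fun i => by have := hk i; fun_prop
    have mff : Measurable fun p : Y × (Fin n → Y) => ⨆ i, (a i + f i p.1 + ∑ j, f i (p.2 j)) :=
      .iSup fun i => by have := hf i; fun_prop
    rw [integral_pi_succ (.iSup fun i => by have := hf i; fun_prop)
        fun y => abs_ciSup_le (bf (n + 1) y),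
      integral_pi_succ (.iSup fun i => by have := hk i; fun_prop)
        fun y => abs_ciSup_le (bk (n + 1) y)]
    simp only [Fin.sum_univ_succ, Fin.cons_zero, Fin.cons_succ, ← add_assoc]
    have bff : ∀ (w : Fin n → Y) y i, |a i + f i y + ∑ j, f i (w j)| ≤ A + Bf + n * Bf :=
      fun w y i => (abs_add_le _ _).trans (add_le_add (baf y i) (abs_sum_fin_le (hBf i) w))
    calc
      _ ≤ ∫ y, ∫ w : Fin n → W, (⨆ i, (a i + f i y + ∑ j, k i (w j)))
            ∂(Measure.pi fun _ => m₂) ∂m₁ := by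
        refine integral_mono ?_ ?_ fun y => ih (fun i => a i + f i y) (A + Bf) (baf y)
        · exact (integrable_of_abs_le mff fun p => abs_ciSup_le (bff p.2 p.1)).integral_prod_left
        · exact (integrable_of_abs_le mfk fun p => abs_ciSup_le (bfk p.2 p.1)).integral_prod_left
      _ = ∫ w : Fin n → W, ∫ y, (⨆ i, (a i + f i y + ∑ j, k i (w j))) ∂m₁
            ∂(Measure.pi fun _ => m₂) :=
        integral_integral_swap (integrable_of_abs_le mfk fun p => abs_ciSup_le (bfk p.2 p.1))
      _ ≤ ∫ w : Fin n → W, ∫ w', (⨆ i, (a i + ∑ j, k i (w j) + k i w')) ∂m₂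
            ∂(Measure.pi fun _ => m₂) := by
        simp only [add_right_comm _ (f _ _)]
        refine integral_mono ?_ ?_ fun w => H _ _ (bk n w)
        · simp only [add_right_comm _ _ (f _ _)]
          exact (integrable_of_abs_le mfk fun p => abs_ciSup_le (bfk p.2 p.1)).integral_prod_right
        · exact (integrable_of_abs_le mkk fun p => abs_ciSup_le (bkk p.2 p.1)).integral_prod_right
      _ = _ := by
        simp_rw [fun (y : W) (ω : Fin n → W) i =>
          add_right_comm (a i) (k i y) (∑ j, k i (ω j))]
        exact (integral_integral_swap
          (integrable_of_abs_le mkk fun p => abs_ciSup_le (bkk p.2 p.1))).symm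

/-- McDiarmid's bounded difference inequality, in the form of a bound on exponential moments. -/
theorem integral_exp_le_of_bounded_difference {m : Measure Y} [IsProbabilityMeasure m] {d : ℝ}
    (hd : 0 ≤ d) (t : ℝ) (n : ℕ) {F : (Fin n → Y) → ℝ} (hF : Measurable F) {B : ℝ}
    (hB : ∀ ω, |F ω| ≤ B) (hdiff : ∀ ω i y, F (Function.update ω i y) - F ω ≤ d) :
    ∫ ω, Real.exp (t * F ω) ∂(Measure.pi fun _ => m) ≤
      Real.exp (t * (∫ ω, F ω ∂(Measure.pi fun _ => m)) + n * d ^ 2 * t ^ 2 / 2) := by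
  induction n with
  | zero =>
    have h : F = fun _ => F isEmptyElim := funext fun ω => congrArg F (Subsingleton.elim _ _)
    rw [h]
    simp
  | succ n ih =>
    have bexp : ∀ {x C : ℝ}, |x| ≤ C → |Real.exp (t * x)| ≤ Real.exp (|t| * C) := by
      intro x C h
      rw [abs_of_pos (Real.exp_pos _), Real.exp_le_exp]
      refine (le_abs_self _).trans ?_
      rw [abs_mul]
      gcongr
    have hFc : Measurable fun p : Y × (Fin n → Y) => F (Fin.cons p.1 p.2) :=
      hF.comp measurable_fin_cons
    have hFy : ∀ y, Measurable fun ω : Fin n → Y => F (Fin.cons y ω) := fun y =>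
      hFc.comp measurable_prodMk_left
    set G : Y → ℝ := fun y => ∫ ω : Fin n → Y, F (Fin.cons y ω) ∂(Measure.pi fun _ => m) with hG
    have hGm : Measurable G := hFc.stronglyMeasurable.integral_prod_right'.measurable
    have hGB : ∀ y, |G y| ≤ B := fun y => abs_integral_le_of_abs_le fun ω => hB _
    have hGint : Integrable G m := integrable_of_abs_le hGm hGB
    have hGd : ∀ y y', G y - G y' ≤ d := by
      intro y y'
      have hi : ∀ y, Integrable (fun ω : Fin n → Y => F (Fin.cons y ω)) (Measure.pi fun _ => m) :=
        fun y => integrable_of_abs_le (hFy y) fun ω => hB _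
      rw [hG]
      dsimp only
      rw [← integral_sub (hi y) (hi y')]
      refine (integral_mono ((hi y).sub (hi y')) (integrable_const d) fun ω => ?_).trans (by simp)
      simpa using hdiff (Fin.cons y' ω) 0 y
    have hGmean : ∀ y, G y - ∫ z, G z ∂m ∈ Set.Icc (-d) d := by
      intro y
      have e : G y - ∫ z, G z ∂m = ∫ z, (G y - G z) ∂m := by
        rw [integral_sub (integrable_const _) hGint]; simp
      rw [e]
      exact abs_le.1 (abs_integral_le_of_abs_le fun z =>
        abs_le.2 ⟨by linarith [hGd z y], hGd y z⟩)
    have hsub := hasSubgaussianMGF_of_mem_Icc_of_integral_eq_zero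
      (hGm.sub_const (∫ z, G z ∂m)).aemeasurable (.of_forall hGmean)
      (by rw [integral_sub hGint (integrable_const _)]; simp)
    have hmgf := hsub.mgf_le t
    have hc : (((‖d - -d‖₊ / 2) ^ 2 : NNReal) : ℝ) = d ^ 2 := by
      simp only [NNReal.coe_pow, NNReal.coe_div, coe_nnnorm, NNReal.coe_ofNat, sub_neg_eq_add,
        Real.norm_eq_abs]
      rw [abs_of_nonneg (by linarith)]
      ring
    rw [hc, mgf] at hmgf
    have hmgf' : ∫ y, Real.exp (t * G y) ∂m ≤
        Real.exp (t * (∫ y, G y ∂m)) * Real.exp (d ^ 2 * t ^ 2 / 2) := by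
      have e : ∀ y, Real.exp (t * G y) =
          Real.exp (t * ∫ y, G y ∂m) * Real.exp (t * (G y - ∫ y, G y ∂m)) := by
        intro y; rw [← Real.exp_add]; ring_nf
      simp_rw [e, integral_const_mul]
      gcongr
    rw [integral_pi_succ (by fun_prop) fun ω => bexp (hB ω), integral_pi_succ hF hB]
    calc
      _ ≤ ∫ y, Real.exp (t * G y) * Real.exp (n * d ^ 2 * t ^ 2 / 2) ∂m := by
        refine integral_mono ?_ ?_ fun y => ?_
        · exact (integrable_of_abs_le (Real.measurable_exp.comp (hFc.const_mul t))
            fun p => bexp (hB _)).integral_prod_left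
        · exact (integrable_of_abs_le (by fun_prop) fun y => bexp (hGB y)).mul_const _
        · rw [← Real.exp_add]
          refine ih (hFy y) (fun ω => hB _) fun ω i z => ?_
          rw [Fin.cons_update]
          exact hdiff _ _ _
      _ ≤ Real.exp (t * (∫ y, G y ∂m)) * Real.exp (d ^ 2 * t ^ 2 / 2) *
            Real.exp (n * d ^ 2 * t ^ 2 / 2) := by
        rw [integral_mul_const]
        gcongr
      _ = _ := by
        rw [← Real.exp_add, ← Real.exp_add]
        push_cast
        congr 1
        ring

theorem measureReal_ge_le_of_bounded_difference {m : Measure Y} [IsProbabilityMeasure m] {d : ℝ}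
    (hd : 0 ≤ d) (n : ℕ) {F : (Fin n → Y) → ℝ} (hF : Measurable F) {B : ℝ}
    (hB : ∀ ω, |F ω| ≤ B) (hdiff : ∀ ω i y, F (Function.update ω i y) - F ω ≤ d)
    {ε : ℝ} (hε : 0 ≤ ε) :
    (Measure.pi fun _ => m).real {ω | ε ≤ F ω - ∫ ω, F ω ∂(Measure.pi fun _ => m)} ≤
      Real.exp (-ε ^ 2 / (2 * (n * d ^ 2))) := by
  set E := ∫ ω, F ω ∂(Measure.pi fun _ => m)
  have hsub : HasSubgaussianMGF (fun ω => F ω - E) (Real.toNNReal (n * d ^ 2))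
      (Measure.pi fun _ => m) := by
    refine ⟨fun t => ?_, fun t => ?_⟩
    · exact integrable_exp_mul_of_mem_Icc (a := -B - E) (b := B - E)
        (hF.sub_const E).aemeasurable (.of_forall fun ω =>
          ⟨by linarith [(abs_le.1 (hB ω)).1], by linarith [(abs_le.1 (hB ω)).2]⟩)
    · have h := integral_exp_le_of_bounded_difference (m := m) hd t n hF hB hdiff
      rw [Real.coe_toNNReal _ (by positivity), mgf]
      have e : ∀ ω, Real.exp (t * (F ω - E)) = Real.exp (-(t * E)) * Real.exp (t * F ω) := by
        intro ω; rw [← Real.exp_add]; ring_nf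
      simp_rw [e, integral_const_mul]
      refine (mul_le_mul_of_nonneg_left h (Real.exp_pos _).le).trans ?_
      rw [← Real.exp_add]
      simp [E]
  have h := hsub.measure_ge_le hε
  rwa [Real.coe_toNNReal _ (by positivity)] at h

end ProductMeasure

section Rademacher

theorem integral_rademacher {ρ : Measure ℝ}
    (hρ : ρ = (2⁻¹ : ℝ≥0∞) • Measure.dirac (1 : ℝ) + (2⁻¹ : ℝ≥0∞) • Measure.dirac (-1 : ℝ))
    (F : ℝ → ℝ) : ∫ x, F x ∂ρ = (F 1 + F (-1)) / 2 := by
  have hi : ∀ x : ℝ, Integrable F ((2⁻¹ : ℝ≥0∞) • Measure.dirac x) := fun x =>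
    (integrable_dirac (by simp)).smul_measure (by simp)
  rw [hρ, integral_add_measure (hi _) (hi _), integral_smul_measure, integral_smul_measure,
    integral_dirac, integral_dirac]
  simp
  ring

/-- Truncation of a real number to `[-1, 1]`. -/
noncomputable def clampOne (x : ℝ) : ℝ := max (-1) (min 1 x)

theorem measurable_clampOne : Measurable clampOne := by
  unfold clampOne
  fun_prop

theorem abs_clampOne_le (x : ℝ) : |clampOne x| ≤ 1 :=
  abs_le.2 ⟨le_max_left _ _, max_le (by norm_num) (min_le_left _ _)⟩

theorem clampOne_of_abs_le {x : ℝ} (h : |x| ≤ 1) : clampOne x = x := by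
  rw [clampOne, min_eq_right (abs_le.1 h).2, max_eq_right (abs_le.1 h).1]

theorem ae_clampOne_rademacher {ρ : Measure ℝ}
    (hρ : ρ = (2⁻¹ : ℝ≥0∞) • Measure.dirac (1 : ℝ) + (2⁻¹ : ℝ≥0∞) • Measure.dirac (-1 : ℝ)) :
    ∀ᵐ x ∂ρ, clampOne x = x := by
  rw [hρ, ae_add_measure_iff]
  constructor <;> refine Measure.ae_smul_measure ?_ _ <;> rw [ae_dirac_eq] <;>
    exact clampOne_of_abs_le (by norm_num)

/-- Symmetrization and contraction for one pair of observations. -/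
theorem integral_ciSup_centered_le {X ι : Type*} [MeasurableSpace X] [Countable ι] [Nonempty ι]
    (μ : Measure X) [IsProbabilityMeasure μ] {ρ : Measure ℝ} [IsProbabilityMeasure ρ]
    (hρ : ρ = (2⁻¹ : ℝ≥0∞) • Measure.dirac (1 : ℝ) + (2⁻¹ : ℝ≥0∞) • Measure.dirac (-1 : ℝ))
    {h u v : ι → X × X → ℝ} {g : ι → X → ℝ} {Bh Bg c : ℝ} (hc : 0 ≤ c)
    (hhm : ∀ i, Measurable (h i)) (huv : ∀ i z, h i z = u i z + v i z)
    (hu : ∀ i z, |u i z| ≤ Bh) (hv : ∀ i z, |v i z| ≤ Bh)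
    (hgm : ∀ i, Measurable (g i)) (hg : ∀ i x, |g i x| ≤ Bg)
    (hul : ∀ i j z, |u i z - u j z| ≤ c * |g i z.1 - g j z.1|)
    (hvl : ∀ i j z, |v i z - v j z| ≤ c * |g i z.2 - g j z.2|)
    (b : ι → ℝ) (B : ℝ) (hb : ∀ i, |b i| ≤ B) :
    ∫ z, (⨆ i, (b i + ((∫ z', h i z' ∂(μ.prod μ)) - h i z))) ∂(μ.prod μ) ≤
      ∫ w, (⨆ i, (b i + 4 * c * clampOne w.1 * g i w.2)) ∂(ρ.prod μ) := by
  have hh : ∀ i z, |h i z| ≤ 2 * Bh := fun i z => by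
    rw [huv]
    linarith [abs_add_le (u i z) (v i z), hu i z, hv i z]
  have hEh : ∀ i, |∫ z, h i z ∂(μ.prod μ)| ≤ 2 * Bh := fun i => abs_integral_le_of_abs_le (hh i)
  have bnd : ∀ {x C : ℝ} (r : ℝ) (i : ι), |x| ≤ C → |b i + r * x| ≤ B + |r| * C := by
    intro x C r i hx
    refine (abs_add_le _ _).trans (add_le_add (hb i) ?_)
    rw [abs_mul]
    gcongr
  have bnd' : ∀ {x C : ℝ} (r : ℝ) (i : ι), |x| ≤ C → |b i - r * x| ≤ B + |r| * C := by
    intro x C r i hx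
    have := bnd (-r) i hx
    rwa [abs_neg, neg_mul, ← sub_eq_add_neg] at this
  have bE : ∀ z i, |b i + ((∫ z', h i z' ∂(μ.prod μ)) - h i z)| ≤ B + (2 * Bh + 2 * Bh) :=
    fun z i => (abs_add_le _ _).trans (add_le_add (hb i)
      ((abs_sub _ _).trans (add_le_add (hEh i) (hh i z))))
  set P : X × X → ℝ := fun z => ⨆ i, (b i + 2 * h i z) with hP
  set M : X × X → ℝ := fun z => ⨆ i, (b i - 2 * h i z) with hM
  have hPi : Integrable P (μ.prod μ) :=
    integrable_of_abs_le (.iSup fun i => by have := hhm i; fun_prop)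
      fun z => abs_ciSup_le fun i => bnd 2 i (hh i z)
  have hMi : Integrable M (μ.prod μ) :=
    integrable_of_abs_le (.iSup fun i => by have := hhm i; fun_prop)
      fun z => abs_ciSup_le fun i => bnd' 2 i (hh i z)
  set Φ : X → ℝ := fun x => ((⨆ i, (b i + 4 * c * g i x)) + ⨆ i, (b i - 4 * c * g i x)) / 2
    with hΦ
  have hΦi : Integrable Φ μ := by
    refine (Integrable.add ?_ ?_).div_const 2
    · exact integrable_of_abs_le (.iSup fun i => by have := hgm i; fun_prop)
        fun x => abs_ciSup_le fun i => bnd (4 * c) i (hg i x)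
    · exact integrable_of_abs_le (.iSup fun i => by have := hgm i; fun_prop)
        fun x => abs_ciSup_le fun i => bnd' (4 * c) i (hg i x)
  have hPE : ⨆ i, (b i + 2 * ∫ z, h i z ∂(μ.prod μ)) ≤ ∫ z, P z ∂(μ.prod μ) := by
    refine ciSup_le fun i => ?_
    have hhi : Integrable (h i) (μ.prod μ) := integrable_of_abs_le (hhm i) (hh i)
    have e : b i + 2 * ∫ z, h i z ∂(μ.prod μ) = ∫ z, (b i + 2 * h i z) ∂(μ.prod μ) := by
      rw [integral_add (integrable_const _) (hhi.const_mul 2), integral_const_mul]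
      simp
    rw [e]
    exact integral_mono ((integrable_const _).add (hhi.const_mul 2)) hPi fun z =>
      le_ciSup (bddAbove_range_of_abs_le fun i => bnd 2 i (hh i z)) i
  have hPM : ∀ z, (P z + M z) / 2 ≤ (Φ z.1 + Φ z.2) / 2 := by
    intro z
    have bu := bddAbove_range_of_abs_le fun i => bnd 4 i (hu i z)
    have bu' := bddAbove_range_of_abs_le fun i => bnd' 4 i (hu i z)
    have bv := bddAbove_range_of_abs_le fun i => bnd 4 i (hv i z)
    have bv' := bddAbove_range_of_abs_le fun i => bnd' 4 i (hv i z)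
    have bg := fun x => bddAbove_range_of_abs_le fun i => bnd (4 * c) i (hg i x)
    have bg' := fun x => bddAbove_range_of_abs_le fun i => bnd' (4 * c) i (hg i x)
    have h₁ : P z ≤ ((⨆ i, (b i + 4 * u i z)) + ⨆ i, (b i + 4 * v i z)) / 2 :=
      ciSup_midpoint_le bu bv fun i => by rw [huv]; ring
    have h₂ : M z ≤ ((⨆ i, (b i - 4 * u i z)) + ⨆ i, (b i - 4 * v i z)) / 2 :=
      ciSup_midpoint_le bu' bv' fun i => by rw [huv]; ring
    have lip : ∀ {x y p q : ℝ}, |x - y| ≤ c * |p - q| →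
        |4 * x - 4 * y| ≤ |4 * c * p - 4 * c * q| := by
      intro x y p q hxy
      rw [← mul_sub, ← mul_sub, abs_mul, abs_mul, abs_of_nonneg (by positivity : (0 : ℝ) ≤ 4 * c),
        abs_of_pos (by norm_num : (0 : ℝ) < 4)]
      linarith
    have h₃ := ciSup_add_add_ciSup_sub_le (b := b) (φ := fun i => 4 * u i z)
      (ψ := fun i => 4 * c * g i z.1) (fun i j => lip (hul i j z)) (bg z.1) (bg' z.1)
    have h₄ := ciSup_add_add_ciSup_sub_le (b := b) (φ := fun i => 4 * v i z)
      (ψ := fun i => 4 * c * g i z.2) (fun i j => lip (hvl i j z)) (bg z.2) (bg' z.2)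
    simp only [hΦ]
    linarith
  calc
    _ ≤ ∫ z, ((⨆ i, (b i + 2 * ∫ z, h i z ∂(μ.prod μ))) + M z) / 2 ∂(μ.prod μ) := by
      refine integral_mono ?_ (((integrable_const _).add hMi).div_const 2) fun z => ?_
      · exact integrable_of_abs_le (.iSup fun i => by have := hhm i; fun_prop)
          fun z => abs_ciSup_le (bE z)
      · exact ciSup_midpoint_le
          (bddAbove_range_of_abs_le fun i => bnd 2 i (hEh i))
          (bddAbove_range_of_abs_le fun i => bnd' 2 i (hh i z)) fun i => by ring
    _ ≤ ∫ z, (P z + M z) / 2 ∂(μ.prod μ) := by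
      rw [integral_div, integral_div, integral_add (integrable_const _) hMi, integral_add hPi hMi]
      simp only [integral_const, probReal_univ, one_smul]
      gcongr
    _ ≤ ∫ z, (Φ z.1 + Φ z.2) / 2 ∂(μ.prod μ) :=
      integral_mono ((hPi.add hMi).div_const 2)
        (((hΦi.comp_fst μ).add (hΦi.comp_snd μ)).div_const 2) hPM
    _ = ∫ x, Φ x ∂μ := by
      rw [integral_div, integral_add (hΦi.comp_fst μ) (hΦi.comp_snd μ), integral_fun_fst,
        integral_fun_snd]
      simp
    _ = _ := by
      rw [integral_prod_symm]
      · refine integral_congr_ae (.of_forall fun x => ?_)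
        dsimp only
        rw [integral_rademacher hρ fun σ => ⨆ i, (b i + 4 * c * clampOne σ * g i x),
          clampOne_of_abs_le (by norm_num), clampOne_of_abs_le (by norm_num)]
        simp [hΦ, sub_eq_add_neg]
      · refine integrable_of_abs_le (B := B + |4 * c| * (1 * Bg)) (.iSup fun i => ?_)
          fun w => abs_ciSup_le fun i => ?_
        · have := hgm i
          have := measurable_clampOne
          fun_prop
        · rw [mul_assoc]
          refine bnd (4 * c) i ?_
          rw [abs_mul]
          exact mul_le_mul (abs_clampOne_le _) (hg i _) (abs_nonneg _) zero_le_one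

end Rademacher

section Deviation

theorem integral_ciSup_rademacher_le {X : Type*} [MeasurableSpace X] (μ : Measure X)
    [IsProbabilityMeasure μ] {ρ : Measure ℝ} [IsProbabilityMeasure ρ]
    (hρ : ρ = (2⁻¹ : ℝ≥0∞) • Measure.dirac (1 : ℝ) + (2⁻¹ : ℝ≥0∞) • Measure.dirac (-1 : ℝ))
    {𝒢 : Set (X → ℝ)} (hne : 𝒢.Nonempty) (hcount : 𝒢.Countable) (hm : ∀ g ∈ 𝒢, Measurable g)
    {C : ℝ} (hC : ∀ g ∈ 𝒢, ∀ x, |g x| ≤ C) {n : ℕ} (hn : 0 < n) {κ : ℝ} (hκ : 0 ≤ κ) :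
    ∫ w : Fin n → ℝ × X, (⨆ g : 𝒢, ∑ j, κ * clampOne (w j).1 * g.1 (w j).2)
        ∂(Measure.pi fun _ => ρ.prod μ) ≤
      κ * n * ∫ x : Fin n → X, ∫ σ : Fin n → ℝ, (⨆ g ∈ 𝒢, (1 / (n : ℝ)) * ∑ i, σ i * g (x i))
        ∂(Measure.pi fun _ : Fin n => ρ) ∂(Measure.pi fun _ : Fin n => μ) := by
  have : Nonempty 𝒢 := hne.to_subtype
  have : Countable 𝒢 := hcount.to_subtype
  have hn' : (0 : ℝ) < n := by exact_mod_cast hn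
  obtain ⟨x₀⟩ : Nonempty X := nonempty_of_isProbabilityMeasure μ
  have hnot : ¬ ∀ g, g ∈ 𝒢 := by
    intro h
    have := hC (fun _ => |C| + 1) (h _) x₀
    rw [abs_of_nonneg (by positivity)] at this
    linarith [le_abs_self C]
  have hcm := measurable_clampOne
  have hterm : ∀ (g : 𝒢) (σ : ℝ) (x : X), |clampOne σ * g.1 x| ≤ C := fun g σ x => by
    rw [abs_mul]
    calc _ ≤ 1 * C :=
          mul_le_mul (abs_clampOne_le _) (hC g.1 g.2 x) (abs_nonneg _) zero_le_one
      _ = C := one_mul C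
  have hsum : ∀ (p : (Fin n → ℝ) × (Fin n → X)) (g : 𝒢),
      |∑ j, clampOne (p.1 j) * g.1 (p.2 j)| ≤ n * C := fun p g =>
    (Finset.abs_sum_le_sum_abs _ _).trans
      ((Finset.sum_le_sum fun j _ => hterm g _ _).trans (by simp))
  have hsumκ : ∀ (p : (Fin n → ℝ) × (Fin n → X)) (g : 𝒢),
      |∑ j, κ * clampOne (p.1 j) * g.1 (p.2 j)| ≤ κ * (n * C) := fun p g => by
    simp_rw [mul_assoc κ, ← Finset.mul_sum]
    rw [abs_mul, abs_of_nonneg hκ]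
    exact mul_le_mul_of_nonneg_left (hsum p g) hκ
  have hsumn : ∀ (p : (Fin n → ℝ) × (Fin n → X)) (g : 𝒢),
      |(1 / (n : ℝ)) * ∑ j, clampOne (p.1 j) * g.1 (p.2 j)| ≤ (1 / (n : ℝ)) * (n * C) :=
    fun p g => by
      rw [abs_mul, abs_of_nonneg (by positivity)]
      exact mul_le_mul_of_nonneg_left (hsum p g) (by positivity)
  set S : (Fin n → ℝ) × (Fin n → X) → ℝ :=
    fun p => ⨆ g : 𝒢, ∑ j, κ * clampOne (p.1 j) * g.1 (p.2 j) with hS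
  set T : (Fin n → ℝ) × (Fin n → X) → ℝ :=
    fun p => max (⨆ g : 𝒢, (1 / (n : ℝ)) * ∑ j, clampOne (p.1 j) * g.1 (p.2 j)) 0 with hT
  have hSi : Integrable S ((Measure.pi fun _ => ρ).prod (Measure.pi fun _ => μ)) :=
    integrable_of_abs_le (.iSup fun g => by have := hm g.1 g.2; fun_prop)
      fun p => abs_ciSup_le (hsumκ p)
  have hTi : Integrable T ((Measure.pi fun _ => ρ).prod (Measure.pi fun _ => μ)) := by
    refine Integrable.sup (integrable_of_abs_le (.iSup fun g => ?_)
      fun p => abs_ciSup_le (hsumn p)) (integrable_const 0)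
    have := hm g.1 g.2
    fun_prop
  have hST : ∀ p, S p ≤ κ * n * T p := fun p => by
    refine ciSup_le fun g => ?_
    have e : ∑ j, κ * clampOne (p.1 j) * g.1 (p.2 j) =
        κ * n * ((1 / (n : ℝ)) * ∑ j, clampOne (p.1 j) * g.1 (p.2 j)) := by
      simp_rw [mul_assoc κ, ← Finset.mul_sum]
      field_simp
    rw [e]
    refine mul_le_mul_of_nonneg_left ?_ (by positivity)
    exact (le_ciSup (bddAbove_range_of_abs_le (hsumn p)) g).trans (le_max_left _ _)
  have hclamp : ∀ᵐ σ ∂(Measure.pi fun _ : Fin n => ρ), ∀ j, clampOne (σ j) = σ j :=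
    ae_all_iff.2 fun j =>
      (Measure.quasiMeasurePreserving_eval (fun _ : Fin n => ρ) j).ae (ae_clampOne_rademacher hρ)
  have hTeq : ∀ x : Fin n → X,
      ∫ σ : Fin n → ℝ, (⨆ g ∈ 𝒢, (1 / (n : ℝ)) * ∑ i, σ i * g (x i))
        ∂(Measure.pi fun _ : Fin n => ρ) = ∫ σ, T (σ, x) ∂(Measure.pi fun _ : Fin n => ρ) := by
    intro x
    refine integral_congr_ae ?_
    filter_upwards [hclamp] with σ hσ
    simp only [hT, hσ]
    simpa [max_comm] using cbiSup_eq_of_not_forall (p := fun g => g ∈ 𝒢)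
      (f := fun g : 𝒢 => (1 / (n : ℝ)) * ∑ i, σ i * g.1 (x i)) hnot
  have hpi := (measurePreserving_arrowProdEquivProdArrow ℝ X (Fin n)
    (fun _ => ρ) (fun _ => μ)).integral_comp' S
  calc
    _ = ∫ p, S p ∂((Measure.pi fun _ => ρ).prod (Measure.pi fun _ => μ)) := hpi
    _ ≤ ∫ p, κ * n * T p ∂((Measure.pi fun _ => ρ).prod (Measure.pi fun _ => μ)) :=
      integral_mono hSi (hTi.const_mul _) hST
    _ = _ := by
      rw [integral_const_mul, integral_prod_symm _ hTi]
      simp_rw [hTeq]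

/-- A high-probability bound on the excess of the empirical mean of `h i₀ - h i`, uniform in `i`. -/
theorem measureReal_deviation_le {X ι : Type*} [MeasurableSpace X] [Countable ι] [Nonempty ι]
    (μ : Measure X) [IsProbabilityMeasure μ] {ρ : Measure ℝ} [IsProbabilityMeasure ρ]
    (hρ : ρ = (2⁻¹ : ℝ≥0∞) • Measure.dirac (1 : ℝ) + (2⁻¹ : ℝ≥0∞) • Measure.dirac (-1 : ℝ))
    {h u v : ι → X × X → ℝ} {g : ι → X → ℝ} {Bh Bg c D : ℝ} (hc : 0 ≤ c) (hD : 0 ≤ D)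
    (hhm : ∀ i, Measurable (h i)) (huv : ∀ i z, h i z = u i z + v i z)
    (hu : ∀ i z, |u i z| ≤ Bh) (hv : ∀ i z, |v i z| ≤ Bh)
    (hgm : ∀ i, Measurable (g i)) (hg : ∀ i x, |g i x| ≤ Bg)
    (hul : ∀ i j z, |u i z - u j z| ≤ c * |g i z.1 - g j z.1|)
    (hvl : ∀ i j z, |v i z - v j z| ≤ c * |g i z.2 - g j z.2|)
    (hdiff : ∀ i z z', h i z - h i z' ≤ D) (i₀ : ι) (n : ℕ) {ε : ℝ} (hε : 0 ≤ ε) :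
    ∃ A : Set (Fin n → X × X), MeasurableSet A ∧
      (Measure.pi fun _ => μ.prod μ).real A ≤ Real.exp (-ε ^ 2 / (2 * (n * (2 * D) ^ 2))) ∧
      ∀ ω ∉ A, ∀ i, ∑ j, ((∫ z, h i z ∂(μ.prod μ)) - h i (ω j)) -
          ∑ j, ((∫ z, h i₀ z ∂(μ.prod μ)) - h i₀ (ω j)) ≤
        (∫ w : Fin n → ℝ × X, (⨆ i, ∑ j, 4 * c * clampOne (w j).1 * g i (w j).2)
          ∂(Measure.pi fun _ => ρ.prod μ)) + ε := by
  have hh : ∀ i z, |h i z| ≤ 2 * Bh := fun i z => by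
    rw [huv]
    linarith [abs_add_le (u i z) (v i z), hu i z, hv i z]
  set f : ι → X × X → ℝ := fun i z => (∫ z', h i z' ∂(μ.prod μ)) - h i z with hf
  have hfm : ∀ i, Measurable (f i) := fun i => measurable_const.sub (hhm i)
  have hfB : ∀ i z, |f i z| ≤ 2 * Bh + 2 * Bh := fun i z =>
    (abs_sub _ _).trans (add_le_add (abs_integral_le_of_abs_le (hh i)) (hh i z))
  have hfdiff : ∀ i z z', f i z - f i z' ≤ D := fun i z z' => by
    simp only [hf]
    linarith [hdiff i z' z]
  have hS : ∀ (ω : Fin n → X × X) i, |∑ j, f i (ω j)| ≤ n * (2 * Bh + 2 * Bh) := fun ω i =>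
    abs_sum_fin_le (hfB i) ω
  have hSd : ∀ (ω : Fin n → X × X) (k : Fin n) (y : X × X) i,
      ∑ j, f i (Function.update ω k y j) = ∑ j, f i (ω j) + (f i y - f i (ω k)) := by
    intro ω k y i
    rw [← Finset.add_sum_erase _ _ (Finset.mem_univ k),
      ← Finset.add_sum_erase _ (fun j => f i (ω j)) (Finset.mem_univ k), Function.update_self,
      Finset.sum_congr rfl fun j hj => by rw [Function.update_of_ne (Finset.ne_of_mem_erase hj)]]
    ring
  set F₁ : (Fin n → X × X) → ℝ := fun ω => ⨆ i, ∑ j, f i (ω j) with hF₁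
  set F : (Fin n → X × X) → ℝ := fun ω => F₁ ω - ∑ j, f i₀ (ω j) with hF
  have hF₁m : Measurable F₁ := .iSup fun i => by have := hfm i; fun_prop
  have hF₁B : ∀ ω, |F₁ ω| ≤ n * (2 * Bh + 2 * Bh) := fun ω => abs_ciSup_le (hS ω)
  have hFm : Measurable F := by have := hfm i₀; fun_prop
  have hFB : ∀ ω, |F ω| ≤ n * (2 * Bh + 2 * Bh) + n * (2 * Bh + 2 * Bh) := fun ω =>
    (abs_sub _ _).trans (add_le_add (hF₁B ω) (hS ω i₀))
  have hFdiff : ∀ ω k y, F (Function.update ω k y) - F ω ≤ 2 * D := by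
    intro ω k y
    have h₁ : F₁ (Function.update ω k y) ≤ F₁ ω + D := by
      refine ciSup_le fun i => ?_
      rw [hSd]
      exact add_le_add (le_ciSup (bddAbove_range_of_abs_le (hS ω)) i) (hfdiff i _ _)
    simp only [hF, hSd]
    linarith [hfdiff i₀ (ω k) y]
  have hmean : ∫ ω, ∑ j, f i₀ (ω j) ∂(Measure.pi fun _ : Fin n => μ.prod μ) = 0 := by
    rw [integral_finsetSum]
    · refine Finset.sum_eq_zero fun j _ => ?_
      rw [integral_comp_eval (μ := fun _ : Fin n => μ.prod μ) (hfm i₀).aestronglyMeasurable,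
        integral_sub (integrable_const _) (integrable_of_abs_le (hhm i₀) (hh i₀))]
      simp
    · intro j _
      exact integrable_of_abs_le ((hfm i₀).comp (measurable_pi_apply j)) fun ω => hfB i₀ _
  have hEF : ∫ ω, F ω ∂(Measure.pi fun _ => μ.prod μ) ≤
      ∫ w : Fin n → ℝ × X, (⨆ i, ∑ j, 4 * c * clampOne (w j).1 * g i (w j).2)
          ∂(Measure.pi fun _ => ρ.prod μ) := by
    rw [hF, integral_sub (integrable_of_abs_le hF₁m hF₁B)
      (integrable_of_abs_le (by have := hfm i₀; fun_prop) fun ω => hS ω i₀), hmean, sub_zero]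
    have hk : ∀ i, Measurable fun w : ℝ × X => 4 * c * clampOne w.1 * g i w.2 := fun i => by
      have := hgm i
      have := measurable_clampOne
      fun_prop
    have hkB : ∀ i (w : ℝ × X), |4 * c * clampOne w.1 * g i w.2| ≤ 4 * c * 1 * Bg :=
      fun i w => by
        rw [abs_mul, abs_mul, abs_of_nonneg (by positivity : (0 : ℝ) ≤ 4 * c)]
        exact mul_le_mul (mul_le_mul_of_nonneg_left (abs_clampOne_le _) (by positivity)) (hg i _)
          (abs_nonneg _) (by positivity)
    have := integral_ciSup_sum_le (μ.prod μ) (ρ.prod μ) hfm hk hfB hkB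
      (integral_ciSup_centered_le μ hρ hc hhm huv hu hv hgm hg hul hvl) n (fun _ => 0) 0 (by simp)
    simpa only [zero_add] using this
  refine ⟨{ω | ε ≤ F ω - ∫ ω, F ω ∂(Measure.pi fun _ => μ.prod μ)},
    measurableSet_le measurable_const (hFm.sub_const _),
    measureReal_ge_le_of_bounded_difference (by positivity) n hFm hFB hFdiff hε, ?_⟩
  intro ω hω i
  rw [Set.mem_ofPred_eq, not_le] at hω
  have hi : ∑ j, f i (ω j) ≤ F₁ ω := le_ciSup (bddAbove_range_of_abs_le (hS ω)) i
  have hFω : F ω = F₁ ω - ∑ j, f i₀ (ω j) := rfl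
  linarith

end Deviation

section SimilarityRisk

variable {X : Type*} [MeasurableSpace X]

theorem withDensity_withDensity_div {ν : Measure X} {w P : X → ℝ} (hw : Measurable w)
    (hP : Measurable P) (hpos : ∀ᵐ x ∂ν, 0 < P x) :
    (ν.withDensity fun x => ENNReal.ofReal (P x)).withDensity
        (fun x => ENNReal.ofReal (w x / P x)) =
      ν.withDensity fun x => ENNReal.ofReal (w x) := by
  rw [← withDensity_mul _ (by fun_prop) (by fun_prop)]
  refine withDensity_congr_ae ?_
  filter_upwards [hpos] with x hx
  rw [Pi.mul_apply, ← ENNReal.ofReal_mul hx.le, mul_div_cancel₀ _ hx.ne']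

theorem integral_div_mul_withDensity {ν : Measure X} {w P : X → ℝ} (hw : Measurable w)
    (hw0 : ∀ x, 0 ≤ w x) (hP : Measurable P) (hP0 : ∀ x, 0 ≤ P x) (hpos : ∀ᵐ x ∂ν, 0 < P x)
    (f : X → ℝ) :
    ∫ x, w x / P x * f x ∂(ν.withDensity fun x => ENNReal.ofReal (P x)) =
      ∫ x, f x ∂(ν.withDensity fun x => ENNReal.ofReal (w x)) := by
  rw [← withDensity_withDensity_div hw hP hpos,
    integral_withDensity_eq_integral_toReal_smul (f := fun x => ENNReal.ofReal (w x / P x))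
      (by fun_prop) (.of_forall fun _ => ENNReal.ofReal_lt_top) f]
  refine integral_congr_ae (.of_forall fun x => ?_)
  simp [ENNReal.toReal_ofReal (div_nonneg (hw0 x) (hP0 x))]

theorem withDensity_mixture {ν : Measure X} {pp pm : X → ℝ} (hpp : Measurable pp)
    (hpm : Measurable pm) (hpp0 : ∀ x, 0 ≤ pp x) (hpm0 : ∀ x, 0 ≤ pm x) {a b : ℝ} (ha : 0 ≤ a)
    (hb : 0 ≤ b) :
    ENNReal.ofReal a • (ν.withDensity fun x => ENNReal.ofReal (pp x)) +
        ENNReal.ofReal b • (ν.withDensity fun x => ENNReal.ofReal (pm x)) =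
      ν.withDensity fun x => ENNReal.ofReal (a * pp x + b * pm x) := by
  rw [← withDensity_smul _ hpp.ennreal_ofReal, ← withDensity_smul _ hpm.ennreal_ofReal,
    ← withDensity_add_left (hpp.ennreal_ofReal.const_smul _)]
  congr 1
  ext x
  simp only [Pi.add_apply, Pi.smul_apply, smul_eq_mul]
  rw [ENNReal.ofReal_add (mul_nonneg ha (hpp0 x)) (mul_nonneg hb (hpm0 x)),
    ENNReal.ofReal_mul ha, ENNReal.ofReal_mul hb]

/-- Expectations of similarity-weighted losses of a pair, where `r` and `q` are the densities of the
classes with respect to the marginal. -/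
theorem integral_similarity_mul {μ μp μm : Measure X} [IsProbabilityMeasure μ]
    [IsProbabilityMeasure μp] [IsProbabilityMeasure μm] {a b : ℝ} (ha : 0 ≤ a) (hb : 0 ≤ b)
    (hμ : μ = ENNReal.ofReal a • μp + ENNReal.ofReal b • μm) {r q : X → ℝ}
    (hr : ∀ f : X → ℝ, ∫ x, r x * f x ∂μ = ∫ x, f x ∂μp)
    (hq : ∀ f : X → ℝ, ∫ x, q x * f x ∂μ = ∫ x, f x ∂μm)
    (hri : Integrable r μ) (hqi : Integrable q μ)
    {f : X → ℝ} (hf : Measurable f) {C : ℝ} (hC : ∀ x, |f x| ≤ C) :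
    ∫ z, (a ^ 2 * r z.1 * r z.2 + b ^ 2 * q z.1 * q z.2 - b) * (f z.1 + f z.2) ∂(μ.prod μ) =
      2 * (a * (a - b) * ∫ x, f x ∂μp) ∧
    ∫ z, (a - (a ^ 2 * r z.1 * r z.2 + b ^ 2 * q z.1 * q z.2)) * (f z.1 + f z.2) ∂(μ.prod μ) =
      2 * (b * (a - b) * ∫ x, f x ∂μm) := by
  have hfi : ∀ {m : Measure X} [IsProbabilityMeasure m], Integrable f m :=
    integrable_of_abs_le hf hC
  have hmix : ∫ x, f x ∂μ = a * ∫ x, f x ∂μp + b * ∫ x, f x ∂μm := by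
    rw [hμ, integral_add_measure (hfi.smul_measure (by simp)) (hfi.smul_measure (by simp)),
      integral_smul_measure, integral_smul_measure, ENNReal.toReal_ofReal ha,
      ENNReal.toReal_ofReal hb, smul_eq_mul, smul_eq_mul]
  have hweight : ∀ {w : X → ℝ} {m : Measure X} [IsProbabilityMeasure m], Integrable w μ →
      (∀ f : X → ℝ, ∫ x, w x * f x ∂μ = ∫ x, f x ∂m) →
      Integrable (fun z : X × X => w z.1 * w z.2 * (f z.1 + f z.2)) (μ.prod μ) ∧
      ∫ z, w z.1 * w z.2 * (f z.1 + f z.2) ∂(μ.prod μ) = 2 * ∫ x, f x ∂m := by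
    intro w m _ hwi hw
    have hwf : Integrable (fun x => w x * f x) μ :=
      hwi.mul_bdd hf.aestronglyMeasurable (.of_forall hC)
    have h₁ : ∫ x, w x ∂μ = 1 := by simpa using hw fun _ => 1
    have e : ∀ z : X × X, w z.1 * w z.2 * (f z.1 + f z.2) =
        w z.1 * f z.1 * w z.2 + w z.1 * (w z.2 * f z.2) := fun z => by ring
    simp_rw [e]
    refine ⟨(hwf.mul_prod hwi).add (hwi.mul_prod hwf), ?_⟩
    rw [integral_add (hwf.mul_prod hwi) (hwi.mul_prod hwf),
      integral_prod_mul (fun x => w x * f x) w, integral_prod_mul w (fun x => w x * f x), hw, h₁]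
    ring
  obtain ⟨ir, er⟩ := hweight hri hr
  obtain ⟨iq, eq⟩ := hweight hqi hq
  have il : Integrable (fun z : X × X => f z.1 + f z.2) (μ.prod μ) :=
    (hfi.comp_fst μ).add (hfi.comp_snd μ)
  have el : ∫ z : X × X, (f z.1 + f z.2) ∂(μ.prod μ) = 2 * ∫ x, f x ∂μ := by
    rw [integral_add (hfi.comp_fst μ) (hfi.comp_snd μ), integral_fun_fst, integral_fun_snd]
    simp
    ring
  have is : Integrable (fun z : X × X => a ^ 2 * (r z.1 * r z.2 * (f z.1 + f z.2)) +
      b ^ 2 * (q z.1 * q z.2 * (f z.1 + f z.2))) (μ.prod μ) :=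
    (ir.const_mul (a ^ 2)).add (iq.const_mul (b ^ 2))
  have es : ∫ z, (a ^ 2 * (r z.1 * r z.2 * (f z.1 + f z.2)) +
      b ^ 2 * (q z.1 * q z.2 * (f z.1 + f z.2))) ∂(μ.prod μ) =
      2 * (a ^ 2 * ∫ x, f x ∂μp) + 2 * (b ^ 2 * ∫ x, f x ∂μm) := by
    rw [integral_add (ir.const_mul _) (iq.const_mul _), integral_const_mul, integral_const_mul,
      er, eq]
    ring
  constructor
  · have e : ∀ z : X × X,
        (a ^ 2 * r z.1 * r z.2 + b ^ 2 * q z.1 * q z.2 - b) * (f z.1 + f z.2) =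
        (a ^ 2 * (r z.1 * r z.2 * (f z.1 + f z.2)) + b ^ 2 * (q z.1 * q z.2 * (f z.1 + f z.2))) -
          b * (f z.1 + f z.2) := fun z => by ring
    simp_rw [e]
    rw [integral_sub is (il.const_mul b), es, integral_const_mul, el, hmix]
    ring
  · have e : ∀ z : X × X,
        (a - (a ^ 2 * r z.1 * r z.2 + b ^ 2 * q z.1 * q z.2)) * (f z.1 + f z.2) =
        a * (f z.1 + f z.2) - (a ^ 2 * (r z.1 * r z.2 * (f z.1 + f z.2)) +
          b ^ 2 * (q z.1 * q z.2 * (f z.1 + f z.2))) := fun z => by ring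
    simp_rw [e]
    rw [integral_sub (il.const_mul a) is, es, integral_const_mul, el, hmix]
    ring

end SimilarityRisk

section Weights

theorem abs_weighted_add_le {a b t x y M : ℝ} (ha : 0 ≤ a) (hb : 0 ≤ b) (hab : a + b = 1)
    (ht : t ∈ Set.Icc (0 : ℝ) 1) (hx : |x| ≤ M) (hy : |y| ≤ M) :
    |(t - b) * x + (a - t) * y| ≤ M := by
  have h : |t - b| + |a - t| ≤ 1 := by
    obtain ⟨h0, h1⟩ := ht
    rcases abs_cases (t - b) with ⟨h, _⟩ | ⟨h, _⟩ <;>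
      rcases abs_cases (a - t) with ⟨h', _⟩ | ⟨h', _⟩ <;> rw [h, h'] <;> linarith
  have hM : 0 ≤ M := (abs_nonneg x).trans hx
  calc |(t - b) * x + (a - t) * y| ≤ |t - b| * |x| + |a - t| * |y| := by
        simpa only [abs_mul] using abs_add_le ((t - b) * x) ((a - t) * y)
    _ ≤ |t - b| * M + |a - t| * M := by gcongr
    _ = (|t - b| + |a - t|) * M := by ring
    _ ≤ M := mul_le_of_le_one_left hM h

theorem weighted_add_mem_Icc {a b t x y M : ℝ} (ha : 0 ≤ a) (hb : 0 ≤ b) (hab : a + b = 1)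
    (ht : t ∈ Set.Icc (0 : ℝ) 1) (hx : x ∈ Set.Icc 0 M) (hy : y ∈ Set.Icc 0 M) :
    (t - b) * x + (a - t) * y ∈ Set.Icc (-(b * M)) (a * M) := by
  have e : (t - b) * x + (a - t) * y = t * (a * x - b * y) + (1 - t) * (a * y - b * x) := by
    obtain rfl : b = 1 - a := by linarith
    ring
  rw [e]
  obtain ⟨t0, t1⟩ := ht
  have h : ∀ {p q : ℝ}, p ∈ Set.Icc 0 M → q ∈ Set.Icc 0 M →
      a * p - b * q ∈ Set.Icc (-(b * M)) (a * M) := fun {p q} hp hq => by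
    have h1 := mul_le_mul_of_nonneg_left hp.2 ha
    have h2 := mul_le_mul_of_nonneg_left hq.2 hb
    have h3 := mul_nonneg ha hp.1
    have h4 := mul_nonneg hb hq.1
    constructor <;> linarith
  have := (convex_Icc (-(b * M)) (a * M)) (h hx hy) (h hy hx) t0 (sub_nonneg.2 t1) (by ring)
  simpa using this

end Weights

theorem sconf_noisy_confidence_bound
    {X : Type*} [MeasurableSpace X] (ν : Measure X) [SigmaFinite ν]
    (pp pm : X → ℝ) (hppm : Measurable pp) (hpmm : Measurable pm)
    (hpp0 : ∀ x, 0 ≤ pp x) (hpm0 : ∀ x, 0 ≤ pm x)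
    (μp μm : Measure X) [IsProbabilityMeasure μp] [IsProbabilityMeasure μm]
    (hμp : μp = ν.withDensity fun x => ENNReal.ofReal (pp x))
    (hμm : μm = ν.withDensity fun x => ENNReal.ofReal (pm x))
    (πp πm : ℝ) (hπp0 : 0 < πp) (hπp1 : πp < 1) (hπm : πm = 1 - πp)
    (hpos : ∀ᵐ x ∂ν, 0 < πp * pp x + πm * pm x)
    (μ : Measure X) [IsProbabilityMeasure μ]
    (hμ : μ = ENNReal.ofReal πp • μp + ENNReal.ofReal πm • μm)
    (s : X → X → ℝ)
    (hs : ∀ x x', s x x' = (πp ^ 2 * pp x * pp x' + πm ^ 2 * pm x * pm x') /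
        ((πp * pp x + πm * pm x) * (πp * pp x' + πm * pm x')))
    (hne : πp ≠ πm)
    (ℓ : ℝ → ℝ → ℝ)
    (hℓm1 : Measurable fun z => ℓ z 1) (hℓm2 : Measurable fun z => ℓ z (-1))
    (hℓ01 : ∀ z, 0 ≤ ℓ z 1) (hℓ02 : ∀ z, 0 ≤ ℓ z (-1))
    (n : ℕ) (hn : 0 < n)
    (Rhatp Rhatm : (X → ℝ) → (Fin n → X × X) → ℝ)
    (hRhatp : ∀ g ω, Rhatp g ω = (1 / (2 * (n : ℝ) * (πp - πm))) *
        ∑ i, (s (ω i).1 (ω i).2 - πm) * (ℓ (g (ω i).1) 1 + ℓ (g (ω i).2) 1))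
    (hRhatm : ∀ g ω, Rhatm g ω = (1 / (2 * (n : ℝ) * (πp - πm))) *
        ∑ i, (πp - s (ω i).1 (ω i).2) * (ℓ (g (ω i).1) (-1) + ℓ (g (ω i).2) (-1)))
    (R : (X → ℝ) → ℝ)
    (hR : ∀ g, R g = πp * (∫ x, ℓ (g x) 1 ∂μp) + πm * ∫ x, ℓ (g x) (-1) ∂μm)
    (𝒢 : Set (X → ℝ)) (h𝒢ne : 𝒢.Nonempty) (h𝒢c : 𝒢.Countable)
    (h𝒢m : ∀ g ∈ 𝒢, Measurable g)
    (Cg : ℝ) (hCg : 0 < Cg) (h𝒢b : ∀ g ∈ 𝒢, ∀ x, |g x| ≤ Cg)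
    (Cl : ℝ) (hCl0 : 0 < Cl)
    (hCl : ∀ z : ℝ, |z| ≤ Cg → ℓ z 1 ≤ Cl ∧ ℓ z (-1) ≤ Cl)
    (Ll : ℝ) (hLl0 : 0 ≤ Ll)
    (hLl1 : LipschitzOnWith (Real.toNNReal Ll) (fun z => ℓ z 1) (Set.Icc (-Cg) Cg))
    (hLl2 : LipschitzOnWith (Real.toNNReal Ll) (fun z => ℓ z (-1)) (Set.Icc (-Cg) Cg))
    (ρ : Measure ℝ) [IsProbabilityMeasure ρ]
    (hρ : ρ = (2⁻¹ : ℝ≥0∞) • Measure.dirac (1 : ℝ) + (2⁻¹ : ℝ≥0∞) • Measure.dirac (-1 : ℝ))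
    (Rad : ℝ)
    (hRad : Rad = ∫ x : Fin n → X, ∫ σ : Fin n → ℝ,
        (⨆ g ∈ 𝒢, (1 / (n : ℝ)) * ∑ i, σ i * g (x i))
        ∂(Measure.pi fun _ : Fin n => ρ) ∂(Measure.pi fun _ : Fin n => μ))
    (sbar : X → X → ℝ) (hsbarm : Measurable fun q : X × X => sbar q.1 q.2)
    (hsbar01 : ∀ x x', sbar x x' ∈ Set.Icc (0 : ℝ) 1)
    (Rbarp Rbarm : (X → ℝ) → (Fin n → X × X) → ℝ)
    (hRbarp : ∀ g ω, Rbarp g ω = (1 / (2 * (n : ℝ) * (πp - πm))) *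
        ∑ i, (sbar (ω i).1 (ω i).2 - πm) * (ℓ (g (ω i).1) 1 + ℓ (g (ω i).2) 1))
    (hRbarm : ∀ g ω, Rbarm g ω = (1 / (2 * (n : ℝ) * (πp - πm))) *
        ∑ i, (πp - sbar (ω i).1 (ω i).2) * (ℓ (g (ω i).1) (-1) + ℓ (g (ω i).2) (-1)))
    (gbar : (Fin n → X × X) → (X → ℝ))
    (hgbar : ∀ ω, gbar ω ∈ 𝒢 ∧ ∀ g ∈ 𝒢, Rbarp (gbar ω) ω + Rbarm (gbar ω) ω ≤ Rbarp g ω + Rbarm g ω)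
    (gstar : X → ℝ) (hgstar : gstar ∈ 𝒢 ∧ ∀ g ∈ 𝒢, R gstar ≤ R g)
    (δ : ℝ) (hδ : δ ∈ Set.Ioo (0 : ℝ) 1) :
    ENNReal.ofReal (1 - δ) ≤
      (Measure.pi fun _ : Fin n => μ.prod μ)
        {ω | R (gbar ω) - R gstar ≤
          4 * Ll * Rad / |πp - πm| +
            (4 * Cl / |πp - πm|) * Real.sqrt (Real.log (2 / δ) / (2 * n)) +
            2 * Cl * (∑ i, |s (ω i).1 (ω i).2 - sbar (ω i).1 (ω i).2|) / ((n : ℝ) * |πp - πm|)} := by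
  have hπm0 : 0 < πm := by linarith
  have hab : πp + πm = 1 := by linarith
  have hΔ : πp - πm ≠ 0 := sub_ne_zero.2 hne
  have hΔ0 : 0 < |πp - πm| := abs_pos.2 hΔ
  have hn' : (0 : ℝ) < n := by exact_mod_cast hn
  set P : X → ℝ := fun x => πp * pp x + πm * pm x with hP
  have hP0 : ∀ x, 0 ≤ P x := fun x =>
    add_nonneg (mul_nonneg hπp0.le (hpp0 x)) (mul_nonneg hπm0.le (hpm0 x))
  have hPm : Measurable P := by fun_prop
  have hμP : μ = ν.withDensity fun x => ENNReal.ofReal (P x) := by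
    rw [hμ, hμp, hμm]
    exact withDensity_mixture hppm hpmm hpp0 hpm0 hπp0.le hπm0.le
  have hbdd : ∀ {w : X → ℝ} {a : ℝ}, 0 < a → (∀ x, 0 ≤ w x) → (∀ x, a * w x ≤ P x) →
      ∀ x, |w x / P x| ≤ 1 / a := by
    intro w a ha hw hwP x
    rw [abs_of_nonneg (div_nonneg (hw x) (hP0 x))]
    refine div_le_of_le_mul₀ (hP0 x) (by positivity) ?_
    rw [div_mul_eq_mul_div, one_mul, le_div_iff₀ ha, mul_comm]
    exact hwP x
  have hri : Integrable (fun x => pp x / P x) μ :=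
    integrable_of_abs_le (hppm.div hPm) (hbdd hπp0 hpp0 fun x =>
      le_add_of_nonneg_right (mul_nonneg hπm0.le (hpm0 x)))
  have hqi : Integrable (fun x => pm x / P x) μ :=
    integrable_of_abs_le (hpmm.div hPm) (hbdd hπm0 hpm0 fun x =>
      le_add_of_nonneg_left (mul_nonneg hπp0.le (hpp0 x)))
  have hr : ∀ f : X → ℝ, ∫ x, pp x / P x * f x ∂μ = ∫ x, f x ∂μp := by
    rw [hμP, hμp]
    exact integral_div_mul_withDensity hppm hpp0 hPm hP0 hpos
  have hq : ∀ f : X → ℝ, ∫ x, pm x / P x * f x ∂μ = ∫ x, f x ∂μm := by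
    rw [hμP, hμm]
    exact integral_div_mul_withDensity hpmm hpm0 hPm hP0 hpos
  have hsrq : ∀ x x', s x x' = πp ^ 2 * (pp x / P x) * (pp x' / P x') +
      πm ^ 2 * (pm x / P x) * (pm x' / P x') := by
    intro x x'
    rw [hs]
    change _ / (P x * P x') = _
    generalize P x = p
    generalize P x' = p'
    rw [div_eq_mul_inv, mul_inv]
    ring
  have hs01 : ∀ x x', s x x' ∈ Set.Icc (0 : ℝ) 1 := by
    intro x x'
    have h₁ := hpp0 x
    have h₂ := hpp0 x'
    have h₃ := hpm0 x
    have h₄ := hpm0 x'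
    have h₅ := hπp0.le
    have h₆ := hπm0.le
    rw [hs]
    refine ⟨by positivity, div_le_one_of_le₀ ?_ (by positivity)⟩
    have : 0 ≤ πp * pp x * (πm * pm x') + πm * pm x * (πp * pp x') := by positivity
    linarith
  have hsm : Measurable fun z : X × X => s z.1 z.2 := by
    simp_rw [hsrq]
    fun_prop
  have : Nonempty 𝒢 := h𝒢ne.to_subtype
  have : Countable 𝒢 := h𝒢c.to_subtype
  have hℓC : ∀ g ∈ 𝒢, ∀ x, ℓ (g x) 1 ∈ Set.Icc 0 Cl ∧ ℓ (g x) (-1) ∈ Set.Icc 0 Cl :=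
    fun g hg x => ⟨⟨hℓ01 _, (hCl _ (h𝒢b g hg x)).1⟩, ⟨hℓ02 _, (hCl _ (h𝒢b g hg x)).2⟩⟩
  have hℓabs : ∀ g ∈ 𝒢, ∀ x, |ℓ (g x) 1| ≤ Cl ∧ |ℓ (g x) (-1)| ≤ Cl := fun g hg x =>
    ⟨by rw [abs_of_nonneg (hℓ01 _)]; exact (hℓC g hg x).1.2,
      by rw [abs_of_nonneg (hℓ02 _)]; exact (hℓC g hg x).2.2⟩
  have hℓlip : ∀ g ∈ 𝒢, ∀ g' ∈ 𝒢, ∀ x, |ℓ (g x) 1 - ℓ (g' x) 1| ≤ Ll * |g x - g' x| ∧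
      |ℓ (g x) (-1) - ℓ (g' x) (-1)| ≤ Ll * |g x - g' x| := by
    intro g hg g' hg' x
    have h := abs_le.1 (h𝒢b g hg x)
    have h' := abs_le.1 (h𝒢b g' hg' x)
    have h₁ := hLl1.dist_le_mul _ h _ h'
    have h₂ := hLl2.dist_le_mul _ h _ h'
    simp only [Real.dist_eq, Real.coe_toNNReal _ hLl0] at h₁ h₂
    exact ⟨h₁, h₂⟩
  set φ : 𝒢 → ℝ → X → ℝ := fun g t x =>
    1 / (2 * (πp - πm)) * ((t - πm) * ℓ (g.1 x) 1 + (πp - t) * ℓ (g.1 x) (-1)) with hφ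
  have habs : |1 / (2 * (πp - πm))| = 1 / (2 * |πp - πm|) := by
    rw [abs_div, abs_mul, abs_one, abs_two]
  have hφB : ∀ g t x, t ∈ Set.Icc (0 : ℝ) 1 → |φ g t x| ≤ 1 / (2 * |πp - πm|) * Cl := by
    intro g t x ht
    rw [hφ, abs_mul, habs]
    have := hℓabs g.1 g.2 x
    exact mul_le_mul_of_nonneg_left
      (abs_weighted_add_le hπp0.le hπm0.le hab ht this.1 this.2) (by positivity)
  have hφlip : ∀ g g' t x, t ∈ Set.Icc (0 : ℝ) 1 →
      |φ g t x - φ g' t x| ≤ Ll / (2 * |πp - πm|) * |g.1 x - g'.1 x| := by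
    intro g g' t x ht
    have e : φ g t x - φ g' t x = 1 / (2 * (πp - πm)) * ((t - πm) *
        (ℓ (g.1 x) 1 - ℓ (g'.1 x) 1) + (πp - t) * (ℓ (g.1 x) (-1) - ℓ (g'.1 x) (-1))) := by
      simp only [hφ]; ring
    rw [e, abs_mul, habs]
    have := hℓlip g.1 g.2 g'.1 g'.2 x
    refine (mul_le_mul_of_nonneg_left
      (abs_weighted_add_le hπp0.le hπm0.le hab ht this.1 this.2) (by positivity)).trans_eq ?_
    ring
  set h : 𝒢 → X × X → ℝ := fun g z => φ g (s z.1 z.2) z.1 + φ g (s z.1 z.2) z.2 with hh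
  have hheq : ∀ g z, h g z = 1 / (2 * (πp - πm)) *
      ((s z.1 z.2 - πm) * (ℓ (g.1 z.1) 1 + ℓ (g.1 z.2) 1) +
        (πp - s z.1 z.2) * (ℓ (g.1 z.1) (-1) + ℓ (g.1 z.2) (-1))) := fun g z => by
    simp only [hh, hφ]; ring
  have hℓg : ∀ g : 𝒢, Measurable (fun x => ℓ (g.1 x) 1) ∧ Measurable (fun x => ℓ (g.1 x) (-1)) :=
    fun g => ⟨hℓm1.comp (h𝒢m g.1 g.2), hℓm2.comp (h𝒢m g.1 g.2)⟩
  have hsum₁ : ∀ g : 𝒢, Measurable fun z : X × X => ℓ (g.1 z.1) 1 + ℓ (g.1 z.2) 1 := fun g =>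
    ((hℓg g).1.comp measurable_fst).add ((hℓg g).1.comp measurable_snd)
  have hsum₂ : ∀ g : 𝒢, Measurable fun z : X × X => ℓ (g.1 z.1) (-1) + ℓ (g.1 z.2) (-1) :=
    fun g => ((hℓg g).2.comp measurable_fst).add ((hℓg g).2.comp measurable_snd)
  have hhm : ∀ g, Measurable (h g) := fun g => by
    rw [funext (hheq g)]
    exact (((hsm.sub_const πm).mul (hsum₁ g)).add
      ((hsm.const_sub πp).mul (hsum₂ g))).const_mul _
  have hhdiff : ∀ g z z', h g z - h g z' ≤ Cl / |πp - πm| := by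
    intro g z z'
    have hw : ∀ z : X × X, (s z.1 z.2 - πm) * (ℓ (g.1 z.1) 1 + ℓ (g.1 z.2) 1) +
        (πp - s z.1 z.2) * (ℓ (g.1 z.1) (-1) + ℓ (g.1 z.2) (-1)) ∈
        Set.Icc (-(πm * (2 * Cl))) (πp * (2 * Cl)) := fun z => by
      obtain ⟨⟨a₁, a₂⟩, a₃, a₄⟩ := hℓC g.1 g.2 z.1
      obtain ⟨⟨b₁, b₂⟩, b₃, b₄⟩ := hℓC g.1 g.2 z.2
      exact weighted_add_mem_Icc hπp0.le hπm0.le hab (hs01 _ _)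
        ⟨by linarith, by linarith⟩ ⟨by linarith, by linarith⟩
    rw [hheq, hheq, ← mul_sub]
    refine (le_abs_self _).trans ?_
    rw [abs_mul, habs]
    have hlen : πp * (2 * Cl) + πm * (2 * Cl) = 2 * Cl := by rw [← add_mul, hab, one_mul]
    calc _ ≤ 1 / (2 * |πp - πm|) * (2 * Cl) := by
          refine mul_le_mul_of_nonneg_left (abs_le.2 ⟨?_, ?_⟩) (by positivity)
          · linarith [(hw z).1, (hw z').2]
          · linarith [(hw z).2, (hw z').1]
      _ = Cl / |πp - πm| := by field_simp
  have hrisk : ∀ g : 𝒢, ∫ z, h g z ∂(μ.prod μ) = R g.1 := by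
    intro g
    have h₁ := (integral_similarity_mul hπp0.le hπm0.le hμ hr hq hri hqi (hℓg g).1
      (fun x => (hℓabs g.1 g.2 x).1)).1
    have h₂ := (integral_similarity_mul hπp0.le hπm0.le hμ hr hq hri hqi (hℓg g).2
      (fun x => (hℓabs g.1 g.2 x).2)).2
    simp_rw [← hsrq] at h₁ h₂
    have hi : ∀ {w f : X × X → ℝ}, Measurable w → Measurable f → (∀ z, |w z| ≤ 1) →
        (∀ z, |f z| ≤ 2 * Cl) → Integrable (fun z => w z * f z) (μ.prod μ) := by
      intro w f hw hf hwB hfB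
      refine integrable_of_abs_le (hw.mul hf) (B := 1 * (2 * Cl)) fun z => ?_
      rw [abs_mul]
      exact mul_le_mul (hwB z) (hfB z) (abs_nonneg _) zero_le_one
    simp_rw [hheq]
    rw [integral_const_mul, integral_add, h₁, h₂, hR]
    · field_simp
    · refine hi (hsm.sub_const πm) (hsum₁ g) (fun z => ?_) fun z => ?_
      · obtain ⟨t0, t1⟩ := hs01 z.1 z.2
        exact abs_le.2 ⟨by linarith, by linarith⟩
      · linarith [abs_add_le (ℓ (g.1 z.1) 1) (ℓ (g.1 z.2) 1), (hℓabs g.1 g.2 z.1).1,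
          (hℓabs g.1 g.2 z.2).1]
    · refine hi (hsm.const_sub πp) (hsum₂ g) (fun z => ?_) fun z => ?_
      · obtain ⟨t0, t1⟩ := hs01 z.1 z.2
        exact abs_le.2 ⟨by linarith, by linarith⟩
      · linarith [abs_add_le (ℓ (g.1 z.1) (-1)) (ℓ (g.1 z.2) (-1)), (hℓabs g.1 g.2 z.1).2,
          (hℓabs g.1 g.2 z.2).2]
  have hRhat : ∀ (g : 𝒢) ω, ∑ j, h g (ω j) = n * (Rhatp g.1 ω + Rhatm g.1 ω) := by
    intro g ω
    rw [hRhatp, hRhatm, ← mul_add, ← Finset.sum_add_distrib]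
    simp_rw [hheq]
    rw [← Finset.mul_sum]
    field_simp
  have hnoise : ∀ (g : 𝒢) ω, |(Rhatp g.1 ω + Rhatm g.1 ω) - (Rbarp g.1 ω + Rbarm g.1 ω)| ≤
      Cl * (∑ i, |s (ω i).1 (ω i).2 - sbar (ω i).1 (ω i).2|) / (n * |πp - πm|) := by
    intro g ω
    have e : (Rhatp g.1 ω + Rhatm g.1 ω) - (Rbarp g.1 ω + Rbarm g.1 ω) =
        1 / (2 * (n : ℝ) * (πp - πm)) * ∑ i, (s (ω i).1 (ω i).2 - sbar (ω i).1 (ω i).2) *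
          ((ℓ (g.1 (ω i).1) 1 + ℓ (g.1 (ω i).2) 1) -
            (ℓ (g.1 (ω i).1) (-1) + ℓ (g.1 (ω i).2) (-1))) := by
      rw [hRhatp, hRhatm, hRbarp, hRbarm, ← mul_add, ← mul_add, ← mul_sub,
        ← Finset.sum_add_distrib, ← Finset.sum_add_distrib, ← Finset.sum_sub_distrib]
      congr 1
      exact Finset.sum_congr rfl fun i _ => by ring
    rw [e, abs_mul, abs_div, abs_mul, abs_mul, abs_one, abs_two, abs_of_pos hn']
    have hsum : |∑ i, (s (ω i).1 (ω i).2 - sbar (ω i).1 (ω i).2) *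
          ((ℓ (g.1 (ω i).1) 1 + ℓ (g.1 (ω i).2) 1) -
            (ℓ (g.1 (ω i).1) (-1) + ℓ (g.1 (ω i).2) (-1)))| ≤
        (∑ i, |s (ω i).1 (ω i).2 - sbar (ω i).1 (ω i).2|) * (2 * Cl) := by
      rw [Finset.sum_mul]
      refine (Finset.abs_sum_le_sum_abs _ _).trans (Finset.sum_le_sum fun i _ => ?_)
      rw [abs_mul]
      refine mul_le_mul_of_nonneg_left (abs_le.2 ?_) (abs_nonneg _)
      obtain ⟨⟨a₁, a₂⟩, a₃, a₄⟩ := hℓC g.1 g.2 (ω i).1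
      obtain ⟨⟨b₁, b₂⟩, b₃, b₄⟩ := hℓC g.1 g.2 (ω i).2
      constructor <;> linarith
    refine (mul_le_mul_of_nonneg_left hsum (by positivity)).trans_eq ?_
    field_simp
  set L := Real.log (2 / δ) with hL
  have hL0 : 0 ≤ L := Real.log_nonneg (by rw [le_div_iff₀ hδ.1]; linarith [hδ.2])
  set t := 4 * Cl / |πp - πm| * Real.sqrt (L / (2 * n)) with ht
  have ht0 : 0 ≤ t := by positivity
  obtain ⟨A, hAm, hA, hAbound⟩ := measureReal_deviation_le μ hρ (h := h)
    (u := fun g z => φ g (s z.1 z.2) z.1) (v := fun g z => φ g (s z.1 z.2) z.2)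
    (g := fun g => g.1) (by positivity : 0 ≤ Ll / (2 * |πp - πm|))
    (by positivity : 0 ≤ Cl / |πp - πm|) hhm (fun g z => rfl)
    (fun g z => hφB g _ _ (hs01 _ _)) (fun g z => hφB g _ _ (hs01 _ _))
    (fun g => h𝒢m g.1 g.2) (fun g => h𝒢b g.1 g.2)
    (fun g g' z => hφlip g g' _ _ (hs01 _ _)) (fun g g' z => hφlip g g' _ _ (hs01 _ _))
    hhdiff ⟨gstar, hgstar.1⟩ n (by positivity : 0 ≤ n * t)
  have hrad := integral_ciSup_rademacher_le μ hρ h𝒢ne h𝒢c h𝒢m h𝒢b hn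
    (by positivity : 0 ≤ 4 * (Ll / (2 * |πp - πm|)))
  rw [← hRad] at hrad
  have hRad0 : 0 ≤ Rad := by
    obtain ⟨x₀⟩ := nonempty_of_isProbabilityMeasure μ
    have hnot : (fun _ => Cg + 1) ∉ 𝒢 := fun hmem => by
      linarith [le_abs_self (Cg + 1), h𝒢b _ hmem x₀]
    rw [hRad]
    exact integral_nonneg fun x => integral_nonneg fun σ =>
      Real.iSup_nonneg' ⟨fun _ => Cg + 1, by simp [hnot]⟩
  have hAδ : (Measure.pi fun _ => μ.prod μ).real A ≤ δ := by
    have hexp : -(n * t) ^ 2 / (2 * (n * (2 * (Cl / |πp - πm|)) ^ 2)) = -L := by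
      rw [ht, mul_pow, mul_pow, Real.sq_sqrt (by positivity)]
      field_simp
      ring
    rw [hexp, hL, Real.exp_neg, Real.exp_log (div_pos two_pos hδ.1), inv_div] at hA
    linarith [hδ.1]
  calc
    ENNReal.ofReal (1 - δ) ≤ (Measure.pi fun _ : Fin n => μ.prod μ) Aᶜ := by
      rw [← ofReal_measureReal, probReal_compl_eq_one_sub hAm]
      exact ENNReal.ofReal_le_ofReal (by linarith)
    _ ≤ _ := by
      refine measure_mono fun ω hω => ?_
      have hdev := hAbound ω hω ⟨gbar ω, (hgbar ω).1⟩
      simp only [Finset.sum_sub_distrib, Finset.sum_const, Finset.card_univ, Fintype.card_fin,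
        nsmul_eq_mul, hrisk, hRhat] at hdev
      have hn₁ := (abs_le.1 (hnoise ⟨gbar ω, (hgbar ω).1⟩ ω)).2
      have hn₂ := (abs_le.1 (hnoise ⟨gstar, hgstar.1⟩ ω)).1
      have hmin := (hgbar ω).2 gstar hgstar.1
      have hdev' : (R (gbar ω) - (Rhatp (gbar ω) ω + Rhatm (gbar ω) ω)) -
          (R gstar - (Rhatp gstar ω + Rhatm gstar ω)) ≤ 2 * Ll * Rad / |πp - πm| + t := by
        refine le_of_mul_le_mul_left ?_ hn'
        refine (le_trans (by linarith) (hdev.trans (add_le_add_left hrad _))).trans_eq ?_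
        field_simp
        ring
      have hdouble : 2 * Ll * Rad / |πp - πm| ≤ 4 * Ll * Rad / |πp - πm| := by
        gcongr
        norm_num
      rw [Set.mem_ofPred_eq]
      have e : 2 * Cl * (∑ i, |s (ω i).1 (ω i).2 - sbar (ω i).1 (ω i).2|) / (n * |πp - πm|) =
        2 * (Cl * (∑ i, |s (ω i).1 (ω i).2 - sbar (ω i).1 (ω i).2|) / (n * |πp - πm|)) := by ring
      rw [e]
      dsimp only at hn₁ hn₂
      linarith
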